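/- For the generic ACC solution R̂ with R₁ = R̂⊗1₃ and R₂ = 1₃⊗R̂ on C^27, the operator e' = 1 − R₁ − R₂ + R₁R₂ + R₂R₁ − R₁R₂R₁ is zero. -/

import Mathlib

open Matrix Polynomial

noncomputable section

/-- `R̂ ⊗ 1` acting on `V ⊗ V ⊗ V` with `V = ℂ^3`. -/
def R1 (R : Matrix (Fin 3 × Fin 3) (Fin 3 × Fin 3) ℂ) :
    Matrix (Fin 3 × Fin 3 × Fin 3) (Fin 3 × Fin 3 × Fin 3) ℂ :=
  fun p q => R (p.1, p.2.1) (q.1, q.2.1) * (if p.2.2 = q.2.2 then 1 else 0)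

/-- `1 ⊗ R̂` acting on `V ⊗ V ⊗ V` with `V = ℂ^3`. -/
def R2 (R : Matrix (Fin 3 × Fin 3) (Fin 3 × Fin 3) ℂ) :
    Matrix (Fin 3 × Fin 3 × Fin 3) (Fin 3 × Fin 3 × Fin 3) ℂ :=
  fun p q => (if p.1 = q.1 then 1 else 0) * R (p.2.1, p.2.2) (q.2.1, q.2.2)

/-- The braid relation `R̂₁R̂₂R̂₁ = R̂₂R̂₁R̂₂`. -/
def Braid (R : Matrix (Fin 3 × Fin 3) (Fin 3 × Fin 3) ℂ) : Prop :=
  R1 R * R2 R * R1 R = R2 R * R1 R * R2 R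

/-- The 3×3 central block of the generic ACC solution. -/
def rhat (a x1 x3 b : ℂ) : Matrix (Fin 3) (Fin 3) ℂ :=
  !![a, x1, b;
     x3 * (a - 1) / b, (x1 * x3 + b) / b, x3;
     x1 ^ 2 * x3 ^ 2 / b ^ 3, -(x1 * (a * b + x1 * x3)) / (a * b ^ 2), -(x1 * x3) / (a * b)]

/-- position within the charge-2 sector: |20⟩, |11⟩, |02⟩. -/
def f2 (p : Fin 3 × Fin 3) : Fin 3 := if p = (2, 0) then 0 else if p = (1, 1) then 1 else 2

/-- The generic ACC solution: identity outside the central 3×3 block. -/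
def Rhat (a x1 x3 b : ℂ) : Matrix (Fin 3 × Fin 3) (Fin 3 × Fin 3) ℂ :=
  fun p q =>
    if (p.1 : ℕ) + (p.2 : ℕ) = 2 ∧ (q.1 : ℕ) + (q.2 : ℕ) = 2 then
      rhat a x1 x3 b (f2 p) (f2 q)
    else if p = q then 1 else 0

/-- The map `w ↦ U ⊗ w` from `V` to `V ⊗ V ⊗ V`, for a two-tensor `U`. -/
def tensorLeft (U : Matrix (Fin 3) (Fin 3) ℂ) : Matrix (Fin 3 × Fin 3 × Fin 3) (Fin 3) ℂ :=
  fun p l => U p.1 p.2.1 * (if p.2.2 = l then 1 else 0)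

/-- The map `w ↦ w ⊗ U` from `V` to `V ⊗ V ⊗ V`, for a two-tensor `U`. -/
def tensorRight (U : Matrix (Fin 3) (Fin 3) ℂ) : Matrix (Fin 3 × Fin 3 × Fin 3) (Fin 3) ℂ :=
  fun p l => (if p.1 = l then 1 else 0) * U p.2.1 p.2.2

/-- The identity on `V ⊗ V` minus the rank-one operator with image `U` and covector `W`. -/
def oneSubRankOne (U W : Matrix (Fin 3) (Fin 3) ℂ) :
    Matrix (Fin 3 × Fin 3) (Fin 3 × Fin 3) ℂ :=
  fun p q => (if p = q then 1 else 0) - U p.1 p.2 * W q.1 q.2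

theorem R1_oneSubRankOne (U W : Matrix (Fin 3) (Fin 3) ℂ) :
    R1 (oneSubRankOne U W) = 1 - tensorLeft U * (tensorLeft W)ᵀ := by
  ext ⟨i, j, k⟩ ⟨i', j', k'⟩
  simp only [R1, oneSubRankOne, tensorLeft, Matrix.sub_apply, Matrix.mul_apply,
    Matrix.one_apply, Matrix.transpose_apply, Prod.mk.injEq]
  by_cases hk : k = k' <;> simp [hk]

theorem R2_oneSubRankOne (U W : Matrix (Fin 3) (Fin 3) ℂ) :
    R2 (oneSubRankOne U W) = 1 - tensorRight U * (tensorRight W)ᵀ := by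
  ext ⟨i, j, k⟩ ⟨i', j', k'⟩
  simp only [R2, oneSubRankOne, tensorRight, Matrix.sub_apply, Matrix.mul_apply,
    Matrix.one_apply, Matrix.transpose_apply, Prod.mk.injEq]
  by_cases hi : i = i' <;> simp [hi]

theorem tensorLeft_transpose_mul_tensorLeft (U W : Matrix (Fin 3) (Fin 3) ℂ) :
    (tensorLeft W)ᵀ * tensorLeft U = (∑ i, ∑ j, W i j * U i j) • 1 := by
  ext l m
  simp only [tensorLeft, Matrix.mul_apply, Matrix.transpose_apply, Fintype.sum_prod_type,
    Matrix.smul_apply, Matrix.one_apply, smul_eq_mul]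
  by_cases h : l = m <;> simp [h, eq_comm]

theorem tensorLeft_transpose_mul_tensorRight (U W : Matrix (Fin 3) (Fin 3) ℂ) :
    (tensorLeft W)ᵀ * tensorRight U = (W * U)ᵀ := by
  ext l m
  simp [tensorLeft, tensorRight, Matrix.mul_apply, Fintype.sum_prod_type, Fin.sum_univ_three]

theorem tensorRight_transpose_mul_tensorLeft (U W : Matrix (Fin 3) (Fin 3) ℂ) :
    (tensorRight W)ᵀ * tensorLeft U = U * W := by
  ext l m
  simp [tensorLeft, tensorRight, Matrix.mul_apply, Fintype.sum_prod_type, Fin.sum_univ_three]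
  fin_cases l <;> fin_cases m <;> simp [mul_comm]

theorem eprime_oneSubRankOne_eq_zero (U W : Matrix (Fin 3) (Fin 3) ℂ)
    (h : (W * U)ᵀ * (U * W) = ((∑ i, ∑ j, W i j * U i j) - 1) • 1) :
    1 - R1 (oneSubRankOne U W) - R2 (oneSubRankOne U W)
      + R1 (oneSubRankOne U W) * R2 (oneSubRankOne U W)
      + R2 (oneSubRankOne U W) * R1 (oneSubRankOne U W)
      - R1 (oneSubRankOne U W) * R2 (oneSubRankOne U W) * R1 (oneSubRankOne U W) = 0 := by
  rw [R1_oneSubRankOne, R2_oneSubRankOne]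
  set s := ∑ i, ∑ j, W i j * U i j
  set P := tensorLeft U * (tensorLeft W)ᵀ with hP
  set Q := tensorRight U * (tensorRight W)ᵀ with hQ
  have hPP : P * P = s • P := by
    calc P * P = tensorLeft U * ((tensorLeft W)ᵀ * tensorLeft U) * (tensorLeft W)ᵀ := by
          simp only [hP, Matrix.mul_assoc]
      _ = s • P := by simp [tensorLeft_transpose_mul_tensorLeft, s, hP]
  have hPQP : P * Q * P = (s - 1) • P := by
    calc P * Q * P = tensorLeft U * (((tensorLeft W)ᵀ * tensorRight U) *
            ((tensorRight W)ᵀ * tensorLeft U)) * (tensorLeft W)ᵀ := by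
          simp only [hP, hQ, Matrix.mul_assoc]
      _ = (s - 1) • P := by
          rw [tensorLeft_transpose_mul_tensorRight, tensorRight_transpose_mul_tensorLeft, h]
          simp [hP]
  calc _ = P * Q * P + P - P * P := by noncomm_ring
    _ = 0 := by rw [hPP, hPQP, sub_smul, one_smul]; abel

/-- The image of `1 - R̂`. -/
def imageTensor (a x1 x3 b : ℂ) : Matrix (Fin 3) (Fin 3) ℂ :=
  !![0, 0, -(a * b + x1 * x3) / (a * b ^ 2); 0, x3 / b, 0; 1, 0, 0]

/-- The covector of the rank-one operator `1 - R̂`. -/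
def covectorTensor (a x1 b : ℂ) : Matrix (Fin 3) (Fin 3) ℂ :=
  !![0, 0, -b; 0, -x1, 0; 1 - a, 0, 0]

theorem Rhat_eq_oneSubRankOne (a x1 x3 b : ℂ) (ha : a ≠ 0) (hb : b ≠ 0)
    (hcon : b ^ 2 * a * (a - 1) + b * x1 * x3 * (a - 1) + a * x1 ^ 2 * x3 ^ 2 = 0) :
    Rhat a x1 x3 b = oneSubRankOne (imageTensor a x1 x3 b) (covectorTensor a x1 b) := by
  ext ⟨i, j⟩ ⟨k, l⟩
  fin_cases i <;> fin_cases j <;> fin_cases k <;> fin_cases l <;>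
    simp [Rhat, rhat, f2, oneSubRankOne, imageTensor, covectorTensor]
  all_goals field_simp
  all_goals first | ring1 | linear_combination hcon

/-- the operator `e' = 1 − R₁ − R₂ + R₁R₂ + R₂R₁ − R₁R₂R₁` vanishes for the
generic ACC solution. -/
theorem generic_eprime_zero (a x1 x3 b : ℂ) (ha : a ≠ 0) (hx1 : x1 ≠ 0) (hx3 : x3 ≠ 0)
    (hb : b ≠ 0)
    (hcon : b ^ 2 * a * (a - 1) + b * x1 * x3 * (a - 1) + a * x1 ^ 2 * x3 ^ 2 = 0) :
    1 - R1 (Rhat a x1 x3 b) - R2 (Rhat a x1 x3 b)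
      + R1 (Rhat a x1 x3 b) * R2 (Rhat a x1 x3 b)
      + R2 (Rhat a x1 x3 b) * R1 (Rhat a x1 x3 b)
      - R1 (Rhat a x1 x3 b) * R2 (Rhat a x1 x3 b) * R1 (Rhat a x1 x3 b) = 0 := by
  rw [Rhat_eq_oneSubRankOne a x1 x3 b ha hb hcon]
  apply eprime_oneSubRankOne_eq_zero
  ext l m
  fin_cases l <;> fin_cases m <;>
    simp [imageTensor, covectorTensor, Matrix.mul_apply, Fin.sum_univ_three]
  all_goals field_simp
  all_goals first | ring1 | linear_combination hcon
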